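/- arXiv:2504.21057 — 2 statements merged into one kernel-verified Lean document; each statement's English description precedes it below -/
import Mathlib

section
/- Let f, g : S → ℂ satisfy the integral Kannappan-sine addition law ∫_S f(xσ(y)t) dμ(t) = f(x)g(y) + f(y)g(x) for all x, y ∈ S. If ∫_S f(t) dμ(t) = 0, then for all x, y ∈ S: f(xσ(y)) · ∫_S ∫_S g(σ(t)s) dμ(s)dμ(t) = [f(x)g(y) + f(y)g(x)] · ∫_S g(s) dμ(s) − g(xσ(y)) · ∫_S ∫_S f(σ(t)s) dμ(s)dμ(t). -/
/-- Integral of `h` against a finitely supported complex measure `μ` on `S`: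
`∫_S h(t) dμ(t) = Σ_t μ(t) h(t)`. -/
noncomputable def mint {S : Type*} (μ : S →₀ ℂ) (h : S → ℂ) : ℂ :=
  μ.sum fun t c => c * h t

theorem mint_add {S : Type*} (μ : S →₀ ℂ) (h k : S → ℂ) :
    mint μ (fun t => h t + k t) = mint μ h + mint μ k := by
  simp only [mint, mul_add, Finsupp.sum_add]

theorem mint_const_mul {S : Type*} (μ : S →₀ ℂ) (c : ℂ) (h : S → ℂ) :
    mint μ (fun t => c * h t) = c * mint μ h := by
  simp only [mint, Finsupp.mul_sum, mul_left_comm]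

theorem mint_mul_const {S : Type*} (μ : S →₀ ℂ) (c : ℂ) (h : S → ℂ) :
    mint μ (fun t => h t * c) = mint μ h * c := by
  simp only [mint, Finsupp.sum_mul, mul_assoc]

theorem stmt_10 {S : Type*} [Semigroup S] (σ : S → S)
    (hσmul : ∀ x y : S, σ (x * y) = σ x * σ y) (hσinv : ∀ x : S, σ (σ x) = x)
    (μ : S →₀ ℂ) (f g : S → ℂ)
    (hf : ∀ x y : S, mint μ (fun t => f (x * σ y * t)) = f x * g y + f y * g x)
    (hf0 : mint μ f = 0) :
    ∀ x y : S,
      f (x * σ y) * mint μ (fun t => mint μ (fun s => g (σ t * s)))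
        = (f x * g y + f y * g x) * mint μ g
          - g (x * σ y) * mint μ (fun t => mint μ (fun s => f (σ t * s))) := by
  intro x y
  have hleft : mint μ (fun t => mint μ fun s => mint μ fun u => f (x * σ y * σ (σ t * s) * u))
      = f (x * σ y) * mint μ (fun t => mint μ fun s => g (σ t * s))
        + mint μ (fun t => mint μ fun s => f (σ t * s)) * g (x * σ y) := by
    simp only [hf, mint_add, mint_const_mul, mint_mul_const]
  have hright : mint μ (fun t => mint μ fun s => mint μ fun u => f (x * σ y * σ (σ t * s) * u))
      = (f x * g y + f y * g x) * mint μ g := by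
    have hassoc : ∀ t s : S, x * σ y * σ (σ t * s) = x * σ y * t * σ s := fun t s => by
      rw [hσmul, hσinv, ← mul_assoc]
    have hinner : ∀ t : S, mint μ (fun s => mint μ fun u => f (x * σ y * t * σ s * u))
        = f (x * σ y * t) * mint μ g := fun t => by
      simp only [hf (x * σ y * t), mint_add, mint_const_mul, mint_mul_const]
      rw [show mint μ (fun s => f s) = 0 from hf0, zero_mul, add_zero]
    simp_rw [hassoc, hinner, mint_mul_const, hf]
  linear_combination hright - hleft
end

section
/- Let f, g : S → ℂ satisfy the integral Kannappan-sine addition law ∫_S f(xσ(y)t) dμ(t) = f(x)g(y) + f(y)g(x) for all x, y ∈ S. If ∫_S f(t) dμ(t) ≠ 0, then there exists a constant α ∈ ℂ such that ∫_S g(xσ(y)t) dμ(t) = g(x)g(y) + α² f(x)f(y) for all x, y ∈ S. -/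
theorem mint_linear {S : Type*} (μ : S →₀ ℂ) (a b : ℂ) (h k : S → ℂ) :
    mint μ (fun t => a * h t + b * k t) = a * mint μ h + b * mint μ k := by
  simp only [mint, Finsupp.sum, Finset.mul_sum, ← Finset.sum_add_distrib]
  exact Finset.sum_congr rfl fun t _ => by ring

/-- The relation between `g` and `f` obtained by integrating `f (x * σ y * σ t * s)` in `t` and `s`
with the two possible bracketings. -/
theorem mint_exchange {S : Type*} [Semigroup S] {σ : S → S}
    (hσmul : ∀ x y : S, σ (x * y) = σ x * σ y) {μ : S →₀ ℂ} {f g : S → ℂ}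
    (hf : ∀ x y : S, mint μ (fun t => f (x * σ y * t)) = f x * g y + f y * g x) (x y : S) :
    mint μ g * f (x * σ y) + mint μ f * g (x * σ y) =
      f x * mint μ (fun t => g (y * t)) + g x * mint μ (fun t => f (y * t)) := by
  have key : (fun t => f (x * σ y) * g t + g (x * σ y) * f t) =
      fun t => f x * g (y * t) + g x * f (y * t) := by
    funext t
    have h₁ := hf x (y * t)
    have h₂ := hf (x * σ y) t
    rw [hσmul, ← mul_assoc, h₂] at h₁
    linear_combination h₁
  have h := congrArg (mint μ) key
  rw [mint_linear, mint_linear] at h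
  linear_combination h

theorem stmt_11 {S : Type*} [Semigroup S] (σ : S → S)
    (hσmul : ∀ x y : S, σ (x * y) = σ x * σ y) (hσinv : ∀ x : S, σ (σ x) = x)
    (μ : S →₀ ℂ) (f g : S → ℂ)
    (hf : ∀ x y : S, mint μ (fun t => f (x * σ y * t)) = f x * g y + f y * g x)
    (hf0 : mint μ f ≠ 0) :
    ∃ α : ℂ, ∀ x y : S,
      mint μ (fun t => g (x * σ y * t)) = g x * g y + α ^ 2 * (f x * f y) := by
  let G : S → S → ℂ := fun x y => mint μ (fun t => g (x * σ y * t))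
  let h : S → ℂ := fun y => (mint μ (G y) - mint μ g * g y) / mint μ f
  have hh (y : S) : mint μ f * h y = mint μ (G y) - mint μ g * g y := mul_div_cancel₀ _ hf0
  have hG (x y : S) : G x y = g x * g y + f x * h y := by
    have key : (fun t => mint μ g * f (x * σ y * t) + mint μ f * g (x * σ y * t)) =
        fun t => f x * G y t + g x * (f y * g t + g y * f t) := by
      funext t
      have e := mint_exchange hσmul hf x (y * σ t)
      rw [hσmul, hσinv, ← mul_assoc, hf] at e
      linear_combination e
    have e := congrArg (mint μ) key
    rw [mint_linear, mint_linear, mint_linear, hf] at e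
    change _ + mint μ f * G x y = _ at e
    apply mul_left_cancel₀ hf0
    linear_combination e - f x * hh y
  have h_eq (y : S) : mint μ f * h y = f y * mint μ h := by
    have e := congrArg (mint μ) (funext (hG y))
    rw [mint_linear] at e
    linear_combination hh y + e
  obtain ⟨α, hα⟩ := IsAlgClosed.exists_pow_nat_eq (mint μ h / mint μ f) two_pos
  refine ⟨α, fun x y => (hG x y).trans ?_⟩
  rw [hα]
  field_simp
  linear_combination f x * h_eq y
end
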